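/- For C₀ > 0 let A = 1/(1+C₀²) and u(x) = e^{−A} exp(A e^{i C₀ x}) for x ∈ ℝ. Then for every C > 0 and every λ > 1 there exists n ∈ ℕ₀ such that ‖∂ₓⁿ u‖_{L^∞(ℝ)} > Cⁿ · n!/(log(n+e))^{λ n}. In other words, u does not satisfy the improved ultra-analytic bound ‖∂ₓⁿ u‖_{L^∞(ℝ)} ≤ Cⁿ n!/(log(n+e))^{λn} for all n ∈ ℕ₀. -/

import Mathlib

open Real

/-- `u(x) = e^{-A} exp(A e^{i C₀ x})` with `A = 1/(1+C₀²)`. -/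
noncomputable def uEx (C₀ : ℝ) : ℝ → ℂ := fun x =>
  ((Real.exp (-(1 / (1 + C₀ ^ 2))) : ℝ) : ℂ) *
    Complex.exp (((1 / (1 + C₀ ^ 2) : ℝ) : ℂ) *
      Complex.exp (Complex.I * (C₀ : ℂ) * (x : ℂ)))

open Polynomial in
/-- Touchard polynomials, normalised by
`(d/dt)ⁿ exp (a eᵗ) = Tₙ(a eᵗ) exp (a eᵗ)`. -/
noncomputable def touchard : ℕ → ℕ[X]
  | 0 => 1
  | n + 1 => X * (touchard n + derivative (touchard n))

theorem touchard_coeff_succ (n k : ℕ) :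
    (touchard (n + 1)).coeff (k + 1) =
      (touchard n).coeff k + (k + 1) * (touchard n).coeff (k + 1) := by
  simp [touchard, Polynomial.coeff_X_mul, Polynomial.coeff_derivative, mul_comm]

theorem one_le_touchard_coeff_self (k : ℕ) : 1 ≤ (touchard k).coeff k := by
  induction k with
  | zero => simp [touchard]
  | succ k ih => rw [touchard_coeff_succ]; omega

theorem pow_le_touchard_coeff (k d : ℕ) : k ^ d ≤ (touchard (k + d)).coeff k := by
  induction d with
  | zero => simpa using one_le_touchard_coeff_self k
  | succ d ih =>
    cases k with
    | zero => simp
    | succ k =>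
      rw [← add_assoc, touchard_coeff_succ, pow_succ']
      exact (Nat.mul_le_mul_left _ ih).trans (Nat.le_add_left _ _)

theorem coeff_mul_pow_le_aeval (p : Polynomial ℕ) (k : ℕ) {a : ℝ} (ha : 0 ≤ a) :
    p.coeff k * a ^ k ≤ Polynomial.aeval a p := by
  rw [Polynomial.aeval_eq_sum_range]
  simp only [nsmul_eq_mul]
  by_cases hk : k ≤ p.natDegree
  · exact Finset.single_le_sum (f := fun i => (p.coeff i : ℝ) * a ^ i)
      (fun i _ => by positivity) (Finset.mem_range.2 (by omega))
  · rw [Polynomial.coeff_eq_zero_of_natDegree_lt (by omega)]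
    simp only [Nat.cast_zero, zero_mul]
    exact Finset.sum_nonneg fun i _ => by positivity

theorem iteratedDeriv_const_mul_exp_mul_exp (a b c : ℂ) (n : ℕ) :
    iteratedDeriv n (fun x : ℝ => c * Complex.exp (a * Complex.exp (b * x))) =
      fun x : ℝ => b ^ n * c * Polynomial.aeval (a * Complex.exp (b * x)) (touchard n) *
        Complex.exp (a * Complex.exp (b * x)) := by
  induction n with
  | zero => simp [touchard]
  | succ n ih =>
    rw [iteratedDeriv_succ, ih]
    funext x
    have hw : HasDerivAt (fun x : ℝ => a * Complex.exp (b * x))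
        (a * (Complex.exp (b * x) * (b * 1))) x :=
      (((Complex.ofRealCLM.hasDerivAt (x := x)).const_mul b).cexp).const_mul a
    have hT := ((touchard n).hasDerivAt_aeval (a * Complex.exp (b * x))).comp x hw
    refine (((hT.const_mul (b ^ n * c)).mul hw.cexp).deriv).trans ?_
    simp only [touchard, map_mul, map_add, Polynomial.aeval_X, Function.comp_apply]
    ring

theorem norm_iteratedDeriv_uEx_zero {C₀ : ℝ} (hC₀ : 0 ≤ C₀) (n : ℕ) :
    ‖iteratedDeriv n (uEx C₀) 0‖ =
      C₀ ^ n * Polynomial.aeval (1 / (1 + C₀ ^ 2)) (touchard n) := by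
  have h := congrFun (iteratedDeriv_const_mul_exp_mul_exp ((1 / (1 + C₀ ^ 2) : ℝ) : ℂ)
    (Complex.I * C₀) ((Real.exp (-(1 / (1 + C₀ ^ 2))) : ℝ) : ℂ) n) 0
  have hA : (0 : ℝ) ≤ 1 / (1 + C₀ ^ 2) := by positivity
  unfold uEx
  rw [h]
  generalize (1 / (1 + C₀ ^ 2) : ℝ) = A at hA
  have hT : Polynomial.aeval (A : ℂ) (touchard n) =
      ((Polynomial.aeval A (touchard n) : ℝ) : ℂ) := by
    simp [Polynomial.aeval_eq_sum_range]
  have hT0 : 0 ≤ Polynomial.aeval A (touchard n) :=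
    le_trans (by positivity) (coeff_mul_pow_le_aeval (touchard n) 0 hA)
  simp only [Complex.ofReal_zero, mul_zero, Complex.exp_zero, mul_one, hT, norm_mul, norm_pow,
    Complex.norm_I, one_mul, Complex.norm_real, Complex.norm_exp_ofReal, Real.norm_eq_abs,
    abs_of_nonneg hT0, abs_of_nonneg hC₀, Real.abs_exp]
  calc _ = C₀ ^ n * Polynomial.aeval A (touchard n) * (Real.exp (-A) * Real.exp A) := by ring
    _ = _ := by rw [← Real.exp_add]; simp

theorem natCast_rpow_le_log_rpow {lam : ℝ} (hlam : 0 ≤ lam) (m : ℕ) :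
    ((m : ℝ) ^ lam) ^ (m * 3 ^ m) ≤
      Real.log (((m * 3 ^ m : ℕ) : ℝ) + Real.exp 1) ^ (lam * ((m * 3 ^ m : ℕ) : ℝ)) := by
  have hlog : (m : ℝ) ≤ Real.log (((m * 3 ^ m : ℕ) : ℝ) + Real.exp 1) := by
    rw [Real.le_log_iff_exp_le (by positivity)]
    rcases Nat.eq_zero_or_pos m with rfl | hm
    · simp
    · have h3 : Real.exp m ≤ (3 : ℝ) ^ m := by
        rw [← mul_one (m : ℝ), Real.exp_nat_mul]
        gcongr
        exact Real.exp_one_lt_three.le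
      have hm' : (1 : ℝ) ≤ m := by exact_mod_cast hm
      have := Real.exp_pos 1
      push_cast
      nlinarith [pow_pos (three_pos : (0 : ℝ) < 3) m]
  rw [← Real.rpow_natCast, ← Real.rpow_mul m.cast_nonneg]
  exact Real.rpow_le_rpow m.cast_nonneg hlog (by positivity)

theorem pow_le_norm_iteratedDeriv_uEx {C₀ : ℝ} (hC₀ : 0 < C₀) {m : ℕ} (hm : 0 < m) :
    (C₀ * 3 ^ m * (1 / (1 + C₀ ^ 2)) / 3) ^ (m * 3 ^ m) ≤
      ‖iteratedDeriv (m * 3 ^ m) (uEx C₀) 0‖ := by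
  rw [norm_iteratedDeriv_uEx_zero hC₀.le]
  have hA : (0 : ℝ) ≤ 1 / (1 + C₀ ^ 2) := by positivity
  have hA1 : 1 / (1 + C₀ ^ 2) ≤ 1 := by
    rw [div_le_one (by positivity)]; nlinarith [sq_nonneg C₀]
  generalize (1 / (1 + C₀ ^ 2) : ℝ) = A at hA hA1
  have hkn : 3 ^ m ≤ m * 3 ^ m := Nat.le_mul_of_pos_left _ hm
  obtain ⟨d, hd⟩ := Nat.exists_eq_add_of_le hkn
  have hcoeff : ((3 : ℝ) ^ m) ^ d ≤ (touchard (m * 3 ^ m)).coeff (3 ^ m) := by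
    rw [hd]; exact_mod_cast pow_le_touchard_coeff (3 ^ m) d
  have hpow : ((3 : ℝ) ^ m / 3) ^ (m * 3 ^ m) = ((3 : ℝ) ^ m) ^ d := by
    rw [div_pow, pow_mul (3 : ℝ) m, hd, pow_add, mul_div_cancel_left₀ _ (by positivity)]
  calc (C₀ * 3 ^ m * A / 3) ^ (m * 3 ^ m)
      = C₀ ^ (m * 3 ^ m) * (((3 : ℝ) ^ m / 3) ^ (m * 3 ^ m) * A ^ (m * 3 ^ m)) := by
        rw [← mul_pow, ← mul_pow]; ring
    _ ≤ C₀ ^ (m * 3 ^ m) * ((touchard (m * 3 ^ m)).coeff (3 ^ m) * A ^ (3 ^ m)) := by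
        rw [hpow]
        gcongr ?_ * (?_ * ?_)
        exact pow_le_pow_of_le_one hA hA1 hkn
    _ ≤ _ := by
        gcongr
        exact coeff_mul_pow_le_aeval _ _ hA

/-- **Failure of the improved bound** (Proposition 2.6(1)): for every `C > 0` and
`λ > 1` the function `u = e^{-A} exp(A e^{iC₀x})` does not satisfy
`‖∂ₓⁿ u‖_{L^∞(ℝ)} ≤ Cⁿ n!/(log(n+e))^{λn}` for all `n`; that is, there exist
`n ∈ ℕ₀` and `x ∈ ℝ` with `|∂ₓⁿ u(x)| > Cⁿ n!/(log(n+e))^{λn}`. -/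
theorem sharp_example_no_improved_bound (C₀ : ℝ) (hC₀ : 0 < C₀)
    (C lam : ℝ) (hC : 0 < C) (hlam : 1 < lam) :
    ∃ (n : ℕ) (x : ℝ),
      C ^ n * (Nat.factorial n : ℝ) /
          Real.log ((n : ℝ) + Real.exp 1) ^ (lam * (n : ℝ)) <
        ‖iteratedDeriv n (uEx C₀) x‖ := by
  set A : ℝ := 1 / (1 + C₀ ^ 2) with hA
  have hA0 : 0 < A := by positivity
  obtain ⟨m, hm⟩ := ((((tendsto_rpow_atTop (sub_pos.2 hlam)).comp
    tendsto_natCast_atTop_atTop).eventually_gt_atTop (C / (C₀ * A / 3))).and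
    (Filter.eventually_gt_atTop 0)).exists
  obtain ⟨hm, hm0⟩ := hm
  have hmR : (0 : ℝ) < m := by exact_mod_cast hm0
  rw [Function.comp_apply, div_lt_iff₀ (by positivity), Real.rpow_sub_one hmR.ne'] at hm
  refine ⟨m * 3 ^ m, 0, lt_of_lt_of_le ?_ (pow_le_norm_iteratedDeriv_uEx hC₀ hm0)⟩
  rw [← hA]
  calc _ ≤ C ^ (m * 3 ^ m) * ((m * 3 ^ m : ℕ) : ℝ) ^ (m * 3 ^ m) /
          ((m : ℝ) ^ lam) ^ (m * 3 ^ m) := by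
        gcongr
        · exact_mod_cast Nat.factorial_le_pow _
        · exact natCast_rpow_le_log_rpow (by linarith) m
    _ = (C * (m * 3 ^ m) / (m : ℝ) ^ lam) ^ (m * 3 ^ m) := by
        rw [div_pow, mul_pow]; push_cast; rfl
    _ < _ := by
        refine pow_lt_pow_left₀ ?_ (by positivity) (by positivity)
        rw [div_lt_iff₀ (by positivity)]
        rw [div_mul_eq_mul_div, lt_div_iff₀ hmR] at hm
        nlinarith [pow_pos (three_pos : (0 : ℝ) < 3) m]
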